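/- Let a, b, c ∈ ℝ with c > b > 0 and let z ∈ (−1,1). Then F(a,b;c;z) = (Γ(c)/(Γ(b)·Γ(c−b))) · ∫_0^1 t^{b−1}·(1−t)^{c−b−1}·(1−z·t)^{−a} dt, where the integral is over t ∈ (0,1) and the powers are real powers; note 1 − z·t > 0 for all t ∈ [0,1]. -/

import Mathlib

/-- The rising factorial (Pochhammer symbol) `(x)_j = x(x+1)⋯(x+j-1)`. -/
noncomputable def risingFactorial (j : ℕ) (x : ℝ) : ℝ := (ascPochhammer ℝ j).eval x

/-- The Gauss hypergeometric function `F(a,b;c;z) = ∑_{j=0}^∞ ((a)_j (b)_j/((c)_j j!)) z^j`. -/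
noncomputable def hypF (a b c z : ℝ) : ℝ :=
  ∑' j : ℕ, risingFactorial j a * risingFactorial j b
    / (risingFactorial j c * (Nat.factorial j : ℝ)) * z ^ j

open MeasureTheory

lemma intervalIntegrable_rpow_mul_one_sub_rpow {u v : ℝ} (hu : 0 < u) (hv : 0 < v) :
    IntervalIntegrable (fun t : ℝ ↦ t ^ (u - 1) * (1 - t) ^ (v - 1)) volume 0 1 := by
  have h := Complex.betaIntegral_convergent (u := u) (v := v) (by simpa) (by simpa)
  rw [intervalIntegrable_iff_integrableOn_Ioc_of_le zero_le_one] at h ⊢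
  refine IntegrableOn.congr_fun h.re (fun t ht ↦ ?_) measurableSet_Ioc
  have h₁ : ((t : ℂ) ^ ((u : ℂ) - 1) * (1 - (t : ℂ)) ^ ((v : ℂ) - 1))
      = ((t ^ (u - 1) * (1 - t) ^ (v - 1) : ℝ) : ℂ) := by
    push_cast [Complex.ofReal_cpow ht.1.le, Complex.ofReal_cpow (sub_nonneg.2 ht.2)]
    rfl
  simp only [h₁]
  exact Complex.ofReal_re _

lemma integral_rpow_mul_one_sub_rpow {u v : ℝ} (hu : 0 < u) (hv : 0 < v) :
    ∫ t in (0:ℝ)..1, t ^ (u - 1) * (1 - t) ^ (v - 1)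
      = Real.Gamma u * Real.Gamma v / Real.Gamma (u + v) := by
  have h := Complex.betaIntegral_eq_Gamma_mul_div u v (by simpa) (by simpa)
  rw [Complex.betaIntegral, intervalIntegral.integral_congr
    (g := fun t : ℝ ↦ ((t ^ (u - 1) * (1 - t) ^ (v - 1) : ℝ) : ℂ)),
    intervalIntegral.integral_ofReal, ← Complex.ofReal_add, Complex.Gamma_ofReal,
    Complex.Gamma_ofReal, Complex.Gamma_ofReal] at h
  · exact_mod_cast h
  · intro t ht
    rw [Set.uIcc_of_le zero_le_one] at ht
    push_cast [Complex.ofReal_cpow ht.1, Complex.ofReal_cpow (sub_nonneg.2 ht.2)]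
    rfl

lemma risingFactorial_pos {x : ℝ} (hx : 0 < x) (n : ℕ) : 0 < risingFactorial n x :=
  ascPochhammer_pos n x hx

lemma Real.Gamma_add_natCast {x : ℝ} (hx : 0 < x) (n : ℕ) :
    Real.Gamma (x + n) = risingFactorial n x * Real.Gamma x := by
  induction n with
  | zero => simp [risingFactorial]
  | succ n ih =>
    rw [Nat.cast_succ, ← add_assoc, Real.Gamma_add_one (by positivity), ih, risingFactorial,
      risingFactorial, ascPochhammer_succ_eval]
    ring

lemma choose_add_sub_one_eq_risingFactorial_div (a : ℝ) (n : ℕ) :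
    Ring.choose (a + n - 1) n = risingFactorial n a / (n.factorial : ℝ) := by
  rw [← Ring.multichoose_eq, risingFactorial, ← Polynomial.ascPochhammer_smeval_eq_eval,
    ← Ring.factorial_nsmul_multichoose_eq_ascPochhammer, nsmul_eq_mul,
    mul_div_cancel_left₀ _ (by positivity)]

lemma mem_eball_zero_one_of_abs_lt {x : ℝ} (hx : |x| < 1) : x ∈ Metric.eball (0 : ℝ) 1 := by
  rw [← ENNReal.ofReal_one, Metric.eball_ofReal]
  simpa using hx

lemma hasSum_one_sub_rpow_neg (a : ℝ) {x : ℝ} (hx : |x| < 1) :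
    HasSum (fun n : ℕ ↦ risingFactorial n a / (n.factorial : ℝ) * x ^ n) ((1 - x) ^ (-a)) := by
  have h := (Real.one_div_one_sub_rpow_hasFPowerSeriesOnBall_zero a).hasSum
    (mem_eball_zero_one_of_abs_lt hx)
  simp only [FormalMultilinearSeries.ofScalars_apply_eq, smul_eq_mul, zero_add,
    choose_add_sub_one_eq_risingFactorial_div] at h
  rwa [Real.rpow_neg (by linarith [(abs_lt.1 hx).2]), ← one_div]

lemma integral_rpow_mul_one_sub_rpow_mul_pow {u v : ℝ} (hu : 0 < u) (hv : 0 < v) (n : ℕ) :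
    ∫ t in (0:ℝ)..1, t ^ (u - 1) * (1 - t) ^ (v - 1) * t ^ n
      = risingFactorial n u / risingFactorial n (u + v)
        * (Real.Gamma u * Real.Gamma v / Real.Gamma (u + v)) := by
  have h : ∫ t in (0:ℝ)..1, t ^ (u - 1) * (1 - t) ^ (v - 1) * t ^ n
      = ∫ t in (0:ℝ)..1, t ^ (u + n - 1) * (1 - t) ^ (v - 1) := by
    simp only [intervalIntegral.integral_of_le zero_le_one]
    refine setIntegral_congr_fun measurableSet_Ioc fun t ht ↦ ?_
    rw [show u + n - 1 = u - 1 + n by ring, Real.rpow_add_natCast ht.1.ne']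
    ring
  rw [h, integral_rpow_mul_one_sub_rpow (by positivity) hv, add_right_comm,
    Real.Gamma_add_natCast hu, Real.Gamma_add_natCast (add_pos hu hv), mul_assoc, mul_div_mul_comm]

lemma hasSum_integral_rpow_mul_one_sub_rpow_mul_one_sub_mul_rpow (a : ℝ) {u v z : ℝ}
    (hu : 0 < u) (hv : 0 < v) (hz : |z| < 1) :
    HasSum (fun n : ℕ ↦ risingFactorial n a / (n.factorial : ℝ) * z ^ n
        * ∫ t in (0:ℝ)..1, t ^ (u - 1) * (1 - t) ^ (v - 1) * t ^ n)
      (∫ t in (0:ℝ)..1, t ^ (u - 1) * (1 - t) ^ (v - 1) * (1 - z * t) ^ (-a)) := by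
  have hs := (hasSum_one_sub_rpow_neg a hz).summable.abs
  have hw := intervalIntegrable_rpow_mul_one_sub_rpow hu hv
  simp only [← intervalIntegral.integral_const_mul]
  refine intervalIntegral.hasSum_integral_of_dominated_convergence
    (fun n t ↦ t ^ (u - 1) * (1 - t) ^ (v - 1)
      * |risingFactorial n a / (n.factorial : ℝ) * z ^ n|) (fun n ↦ ?_)
    (fun n ↦ .of_forall fun t ht ↦ ?_) (.of_forall fun t _ ↦ hs.mul_left _) ?_
    (.of_forall fun t ht ↦ ?_)
  · exact Measurable.aestronglyMeasurable (by fun_prop)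
  · rw [Set.uIoc_of_le zero_le_one] at ht
    have h₀ : 0 ≤ t := ht.1.le
    have h₁ : 0 ≤ 1 - t := sub_nonneg.2 ht.2
    have h₂ : 0 ≤ t ^ (u - 1) * (1 - t) ^ (v - 1) := by positivity
    rw [norm_mul, Real.norm_eq_abs, Real.norm_of_nonneg (by positivity), mul_comm]
    exact mul_le_mul_of_nonneg_right (mul_le_of_le_one_right h₂ (pow_le_one₀ h₀ ht.2))
      (abs_nonneg _)
  · simp only [tsum_mul_left]
    exact hw.mul_const _
  · rw [Set.uIoc_of_le zero_le_one] at ht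
    have hzt : |z * t| < 1 := by
      rw [abs_mul, abs_of_pos ht.1]
      exact (mul_le_of_le_one_right (abs_nonneg z) ht.2).trans_lt hz
    refine ((hasSum_one_sub_rpow_neg a hzt).mul_left _).congr_fun fun n ↦ ?_
    rw [mul_pow]
    ring

/-- Euler's integral representation: for `c > b > 0` and `z ∈ (-1,1)`,
`F(a,b;c;z) = (Γ(c)/(Γ(b)Γ(c-b))) ∫_0^1 t^{b-1}(1-t)^{c-b-1}(1-zt)^{-a} dt`. -/
theorem euler_integral_representation
    (a b c : ℝ) (hb : 0 < b) (hcb : b < c) (z : ℝ) (hz : z ∈ Set.Ioo (-1 : ℝ) 1) :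
    hypF a b c z
      = Real.Gamma c / (Real.Gamma b * Real.Gamma (c - b))
        * ∫ t in (0:ℝ)..1, t ^ (b - 1) * (1 - t) ^ (c - b - 1) * (1 - z * t) ^ (-a) := by
  have hv : 0 < c - b := sub_pos.2 hcb
  have hc : 0 < c := hb.trans hcb
  rw [← (hasSum_integral_rpow_mul_one_sub_rpow_mul_one_sub_mul_rpow a hb hv
    (abs_lt.2 hz)).tsum_eq, ← tsum_mul_left, hypF]
  refine tsum_congr fun n ↦ ?_
  have hΓb := (Real.Gamma_pos_of_pos hb).ne'
  have hΓv := (Real.Gamma_pos_of_pos hv).ne'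
  have hΓc := (Real.Gamma_pos_of_pos hc).ne'
  have hrc := (risingFactorial_pos hc n).ne'
  rw [integral_rpow_mul_one_sub_rpow_mul_pow hb hv, add_sub_cancel]
  field_simp
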